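/- Let 0<q<1 and v>-1. For every f ∈ L_{q,1,v} one has F_{q,v}(F_{q,v}f)(x) = f(x) for all x ∈ ℝ_q^+ (all the Jackson q-integrals involved converging absolutely). -/

import Mathlib

open scoped BigOperators

noncomputable section

/-- Finite q-Pochhammer symbol `(a;q)_n = ∏_{i=0}^{n-1} (1 - a q^i)`. -/
def qPoch (a q : ℝ) (n : ℕ) : ℝ := ∏ i ∈ Finset.range n, (1 - a * q ^ i)

/-- Infinite q-Pochhammer symbol `(a;q)_∞ = ∏_{i=0}^{∞} (1 - a q^i)`. -/
def qPochInf (a q : ℝ) : ℝ := ∏' i : ℕ, (1 - a * q ^ i)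

/-- Normalized Hahn–Exton q-Bessel function `j_v(x,q²)`. -/
def jHE (q v x : ℝ) : ℝ :=
  ∑' n : ℕ, (-1 : ℝ) ^ n * q ^ (n * (n + 1)) * x ^ (2 * n) /
    (qPoch (q ^ 2) (q ^ 2) n * qPoch (q ^ (2 * v + 2)) (q ^ 2) n)

/-- Hahn–Exton q-Bessel function with base `p`:
`J_v(x,p) = (x^v/(p;p)_∞) Σ_{n} (-1)^n p^{n(n+1)/2} (p^{v+n+1};p)_∞ x^{2n}/(p;p)_n`.
With `p = q²` this is `J_v(x,q²)`. -/
def JHE (p v x : ℝ) : ℝ :=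
  (x ^ v / qPochInf p p) *
    ∑' n : ℕ, (-1 : ℝ) ^ n * p ^ (((n : ℝ) * ((n : ℝ) + 1)) / 2) *
      qPochInf (p ^ (v + (n : ℝ) + 1)) p * x ^ (2 * n) / qPoch p p n

/-- The constant `c_{q,v}`. -/
def cqv (q v : ℝ) : ℝ :=
  (1 / (1 - q)) * qPochInf (q ^ (2 * v + 2)) (q ^ 2) / qPochInf (q ^ 2) (q ^ 2)

/-- Jackson q-integral on `[0,∞)`: `∫_0^∞ f(x) d_q x = (1-q) Σ_{n∈ℤ} q^n f(q^n)`. -/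
def jackson (q : ℝ) (f : ℝ → ℝ) : ℝ := (1 - q) * ∑' n : ℤ, q ^ n * f (q ^ n)

/-- The q-lattice `ℝ_q^+ = {q^n : n ∈ ℤ}`. -/
def Rq (q : ℝ) : Set ℝ := {x | ∃ n : ℤ, x = q ^ n}

/-- Membership in `L_{q,1,v}`: the Jackson integral `∫_0^∞ |f(x)| x^{2v+1} d_q x`
converges (absolutely). -/
def memL1 (q v : ℝ) (f : ℝ → ℝ) : Prop :=
  Summable fun n : ℤ => q ^ n * |f (q ^ n)| * (q ^ n) ^ (2 * v + 1 : ℝ)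

/-- q-Bessel Fourier transform `F_{q,v}`. -/
def qFourier (q v : ℝ) (f : ℝ → ℝ) (x : ℝ) : ℝ :=
  cqv q v * jackson q fun t => f t * jHE q v (x * t) * t ^ (2 * v + 1 : ℝ)

/-- q-translation operator `T_{q,x}^v`. -/
def qTrans (q v x : ℝ) (f : ℝ → ℝ) (y : ℝ) : ℝ :=
  cqv q v * jackson q fun t =>
    qFourier q v f t * jHE q v (x * t) * jHE q v (y * t) * t ^ (2 * v + 1 : ℝ)

/-- The kernel `D_v(x,y,z)`. -/
def Dker (q v x y z : ℝ) : ℝ :=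
  (cqv q v) ^ 2 * jackson q fun t =>
    jHE q v (x * t) * jHE q v (y * t) * jHE q v (z * t) * t ^ (2 * v + 1 : ℝ)

/-- Positivity of the q-translation operator `T_{q,x}^v`. -/
def IsPosT (q v x : ℝ) : Prop :=
  ∀ f : ℝ → ℝ, memL1 q v f → (∀ y ∈ Rq q, 0 ≤ f y) → ∀ y ∈ Rq q, 0 ≤ qTrans q v x f y

/-- The positivity domain `Q_v`. -/
def Qset (v : ℝ) : Set ℝ :=
  {q | q ∈ Set.Ioo (0 : ℝ) 1 ∧ ∀ x ∈ Rq q, IsPosT q v x}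

/-- The kernel `E_{v,x}(q^m,q^z,q^k)`. -/
def Ekern (q v x : ℝ) (m z k : ℤ) : ℝ :=
  (1 / ((1 - q) ^ 2 * cqv q v * cqv q (x - v))) *
    q ^ (-(k : ℝ) * (x + 2) - (m : ℝ) * v - (z : ℝ) * (x - v)) *
    JHE (q ^ 2) ((z : ℝ) - (k : ℝ)) (q ^ (x - v + (m : ℝ) - (k : ℝ))) *
    JHE (q ^ 2) (v + (z : ℝ) - (k : ℝ)) (q ^ ((m : ℝ) - (k : ℝ)))

/-- The function `q ↦ ₁φ₁(0;q;q,q) = Σ_{n} (-1)^n q^{n(n+1)/2} q^n /((q;q)_n)²`. -/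
def phiQ (q : ℝ) : ℝ :=
  ∑' n : ℕ, (-1 : ℝ) ^ n * q ^ (((n : ℝ) * ((n : ℝ) + 1)) / 2) * q ^ n / (qPoch q q n) ^ 2

/-- Coefficients of Euler's expansion `(z;p)_∞ = ∑ eulerCoeff p k * z ^ k`. -/
def eulerCoeff (p : ℝ) (k : ℕ) : ℝ := ∏ i ∈ Finset.range k, (-p ^ i / (1 - p ^ (i + 1)))

/-- The power series of `(z;p)_∞`. -/
def eulerSeries (p z : ℝ) : ℝ := ∑' k : ℕ, eulerCoeff p k * z ^ k

/-- `eulerCoeff` extended by zero to the integers. -/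
def eulerCoeffInt (p : ℝ) (n : ℤ) : ℝ := if n < 0 then 0 else eulerCoeff p n.toNat

/-- The coefficients `1 / (p;p)_n` of `1 / (z;p)_∞`, extended by zero to the integers. -/
def invEulerCoeff (p : ℝ) (n : ℤ) : ℝ := eulerSeries p (p ^ (n + 1)) / eulerSeries p p

/-- The Laurent coefficients of `(a/t;p)_∞ / (t;p)_∞` in the annulus `|a| < |t| < 1`. -/
def besselCoeff (p a : ℝ) (n : ℤ) : ℝ :=
  ∑' i : ℤ, eulerCoeffInt p i * a ^ i * invEulerCoeff p (n + i)

section Fubini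

lemma summable_mul_mul_of_bounded {ι κ : Type*} {u : ι → ℝ} {w : κ → ℝ} (hu : Summable u)
    (hw : Summable w) {M : ι → κ → ℝ} {B : ℝ} (hM : ∀ i j, |M i j| ≤ B) :
    Summable fun x : ι × κ => u x.1 * (w x.2 * M x.1 x.2) := by
  refine Summable.of_norm_bounded ((hu.norm.mul_of_nonneg hw.norm (fun _ => norm_nonneg _)
    (fun _ => norm_nonneg _)).mul_right B) fun x => ?_
  rw [← mul_assoc, norm_mul, norm_mul]
  exact mul_le_mul_of_nonneg_left (hM _ _) (by positivity)

lemma tsum_mul_tsum_mul_comm {ι κ : Type*} {u : ι → ℝ} {w : κ → ℝ} (hu : Summable u)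
    (hw : Summable w) {M : ι → κ → ℝ} {B : ℝ} (hM : ∀ i j, |M i j| ≤ B) :
    ∑' i, u i * ∑' j, w j * M i j = ∑' j, w j * ∑' i, u i * M i j := by
  simp_rw [← tsum_mul_left]
  rw [Summable.tsum_comm (f := fun j i => u i * (w j * M i j))
    (summable_mul_mul_of_bounded hu hw hM).prod_symm]
  exact tsum_congr fun j => tsum_congr fun i => mul_left_comm _ _ _

lemma summable_convolution {b e χ : ℤ → ℝ} (hb : Summable b) (he : Summable e) {B : ℝ}
    (hχ : ∀ m, |χ m| ≤ B) : Summable fun x : ℤ × ℤ => b x.1 * (e (x.1 - x.2) * χ x.2) := by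
  rw [← (Equiv.prodShear (Equiv.refl ℤ) (fun l => Equiv.subLeft l)).summable_iff]
  convert summable_mul_mul_of_bounded hb he (M := fun l j => χ (l - j)) (fun _ _ => hχ _) using 2
  simp [Equiv.prodShear]

lemma summable_mul_tsum_convolution {b e χ : ℤ → ℝ} (hb : Summable b) (he : Summable e) {B : ℝ}
    (hχ : ∀ m, |χ m| ≤ B) : Summable fun m => χ m * ∑' l, b l * e (l - m) := by
  have h := (summable_convolution hb he hχ).prod_symm.prod
  refine h.congr fun m => ?_
  rw [← tsum_mul_left]
  exact tsum_congr fun l => by simp only [Prod.swap]; ring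

lemma tsum_mul_tsum_convolution {b e χ : ℤ → ℝ} (hb : Summable b) (he : Summable e) {B : ℝ}
    (hχ : ∀ m, |χ m| ≤ B) :
    ∑' m, χ m * ∑' l, b l * e (l - m) = ∑' l, b l * ∑' j, e j * χ (l - j) := by
  calc ∑' m, χ m * ∑' l, b l * e (l - m) = ∑' m, ∑' l, b l * (e (l - m) * χ m) := by
        refine tsum_congr fun m => ?_
        rw [← tsum_mul_left]
        exact tsum_congr fun l => by ring
    _ = ∑' l, ∑' m, b l * (e (l - m) * χ m) :=
        Summable.tsum_comm (f := fun l m => b l * (e (l - m) * χ m))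
          (summable_convolution hb he hχ)
    _ = _ := by
        refine tsum_congr fun l => ?_
        rw [tsum_mul_left, ← (Equiv.subLeft l).tsum_eq fun m => e (l - m) * χ m]
        simp

end Fubini

section Euler

variable {p a : ℝ}

lemma one_sub_pow_succ_pos (hp0 : 0 < p) (hp1 : p < 1) (k : ℕ) : 0 < 1 - p ^ (k + 1) :=
  sub_pos.2 (pow_lt_one₀ hp0.le hp1 (by omega))

lemma eulerCoeff_zero : eulerCoeff p 0 = 1 := by simp [eulerCoeff]

lemma eulerCoeff_succ (k : ℕ) :
    eulerCoeff p (k + 1) = eulerCoeff p k * (-p ^ k / (1 - p ^ (k + 1))) := by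
  rw [eulerCoeff, Finset.prod_range_succ, ← eulerCoeff]

lemma eulerCoeff_succ_mul (hp0 : 0 < p) (hp1 : p < 1) (k : ℕ) :
    eulerCoeff p (k + 1) * (1 - p ^ (k + 1)) = -(p ^ k * eulerCoeff p k) := by
  have := (one_sub_pow_succ_pos hp0 hp1 k).ne'
  rw [eulerCoeff_succ]
  field_simp

lemma eulerCoeff_ne_zero (hp0 : 0 < p) (hp1 : p < 1) (k : ℕ) : eulerCoeff p k ≠ 0 := by
  refine Finset.prod_ne_zero_iff.2 fun i _ => ?_
  exact div_ne_zero (neg_ne_zero.2 (pow_pos hp0 _).ne') (one_sub_pow_succ_pos hp0 hp1 i).ne'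

lemma summable_eulerCoeff_mul_pow (hp0 : 0 < p) (hp1 : p < 1) (z : ℝ) :
    Summable fun k : ℕ => eulerCoeff p k * z ^ k := by
  rcases eq_or_ne z 0 with rfl | hz
  · exact summable_of_ne_finset_zero (s := {0}) fun k hk => by
      simp at hk
      simp [hk]
  refine summable_of_ratio_test_tendsto_lt_one (l := 0) one_pos
    (Filter.Eventually.of_forall fun k => mul_ne_zero (eulerCoeff_ne_zero hp0 hp1 k)
      (pow_ne_zero _ hz)) ?_
  have h1 := tendsto_pow_atTop_nhds_zero_of_lt_one hp0.le hp1
  have h2 : Filter.Tendsto (fun k : ℕ => ‖-p ^ k / (1 - p ^ (k + 1)) * z‖) Filter.atTop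
      (nhds ‖-0 / (1 - 0) * z‖) :=
    (((h1.neg).div (tendsto_const_nhds.sub ((Filter.tendsto_add_atTop_iff_nat 1).2 h1))
      (by norm_num)).mul_const z).norm
  simp only [neg_zero, zero_div, zero_mul, norm_zero] at h2
  refine h2.congr fun k => ?_
  rw [← norm_div, eulerCoeff_succ, pow_succ]
  congr 1
  have := eulerCoeff_ne_zero hp0 hp1 k
  field_simp
  rw [pow_succ']

lemma summable_eulerCoeff (hp0 : 0 < p) (hp1 : p < 1) : Summable (eulerCoeff p) := by
  simpa using summable_eulerCoeff_mul_pow hp0 hp1 1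

lemma eulerSeries_zero : eulerSeries p 0 = 1 := by
  rw [eulerSeries, tsum_eq_single 0 fun k hk => by simp [hk]]
  simp [eulerCoeff_zero]

lemma eulerSeries_eq (hp0 : 0 < p) (hp1 : p < 1) (z : ℝ) :
    eulerSeries p z = (1 - z) * eulerSeries p (z * p) := by
  have hs := summable_eulerCoeff_mul_pow hp0 hp1 z
  have hs' := summable_eulerCoeff_mul_pow hp0 hp1 (z * p)
  have hd : eulerSeries p z - eulerSeries p (z * p) = -z * eulerSeries p (z * p) := by
    unfold eulerSeries
    rw [← hs.tsum_sub hs', (hs.sub hs').tsum_eq_zero_add, ← tsum_mul_left]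
    simp only [pow_zero, sub_self, zero_add]
    refine tsum_congr fun k => ?_
    have := eulerCoeff_succ_mul hp0 hp1 k
    rw [mul_pow, mul_pow]
    linear_combination z ^ (k + 1) * this
  linear_combination hd

lemma eulerSeries_eq_prod (hp0 : 0 < p) (hp1 : p < 1) (z : ℝ) (n : ℕ) :
    eulerSeries p z = qPoch z p n * eulerSeries p (z * p ^ n) := by
  induction n with
  | zero => simp [qPoch]
  | succ n ih =>
    rw [ih, eulerSeries_eq hp0 hp1 (z * p ^ n), qPoch, qPoch, Finset.prod_range_succ, pow_succ]
    ring_nf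

lemma abs_eulerSeries_le (hp0 : 0 < p) (hp1 : p < 1) {z : ℝ} (hz : |z| ≤ 1) :
    |eulerSeries p z| ≤ ∑' k, |eulerCoeff p k| := by
  rw [← Real.norm_eq_abs, eulerSeries]
  refine tsum_of_norm_bounded (summable_eulerCoeff hp0 hp1).abs.hasSum fun k => ?_
  rw [Real.norm_eq_abs, abs_mul, abs_pow]
  exact mul_le_of_le_one_right (abs_nonneg _) (pow_le_one₀ (abs_nonneg _) hz)

lemma tendsto_eulerSeries (hp0 : 0 < p) (hp1 : p < 1) (z : ℝ) :
    Filter.Tendsto (fun n : ℕ => eulerSeries p (z * p ^ n)) Filter.atTop (nhds 1) := by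
  rw [← eulerSeries_zero (p := p)]
  refine tendsto_tsum_of_dominated_convergence
    (summable_eulerCoeff_mul_pow hp0 hp1 z).norm (fun k => ?_)
    (Filter.Eventually.of_forall fun n k => ?_)
  · have h := (tendsto_pow_atTop_nhds_zero_of_lt_one hp0.le hp1).const_mul z
    rw [mul_zero] at h
    exact (h.pow k).const_mul _
  · rw [norm_mul, norm_mul, norm_pow, norm_pow, norm_mul]
    gcongr
    refine mul_le_of_le_one_right (norm_nonneg _) ?_
    rw [norm_pow, Real.norm_of_nonneg hp0.le]
    exact pow_le_one₀ hp0.le hp1.le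

lemma eulerSeries_ne_zero (hp0 : 0 < p) (hp1 : p < 1) {z : ℝ} (hz0 : 0 < z) (hz1 : z < 1) :
    eulerSeries p z ≠ 0 := by
  obtain ⟨n, hn⟩ := ((tendsto_eulerSeries hp0 hp1 z).eventually_ne one_ne_zero).exists
  rw [eulerSeries_eq_prod hp0 hp1 z n]
  refine mul_ne_zero (Finset.prod_ne_zero_iff.2 fun i _ => ?_) hn
  have := mul_lt_one_of_nonneg_of_lt_one_left hz0.le hz1 (pow_le_one₀ hp0.le hp1.le (n := i))
  exact (sub_pos.2 this).ne'

lemma qPochInf_eq_eulerSeries (hp0 : 0 < p) (hp1 : p < 1) (z : ℝ) :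
    qPochInf z p = eulerSeries p z := by
  have hm : Multipliable fun i : ℕ => 1 - z * p ^ i := by
    have hs : Summable fun i : ℕ => ‖-(z * p ^ i)‖ :=
      ((summable_geometric_of_lt_one hp0.le hp1).mul_left z).neg.norm
    simpa [sub_eq_add_neg] using multipliable_one_add_of_summable hs
  have h1 := hm.hasProd.tendsto_prod_nat
  have h2 := h1.mul (tendsto_eulerSeries hp0 hp1 z)
  rw [mul_one] at h2
  refine tendsto_nhds_unique h2 (tendsto_const_nhds.congr fun n => ?_)
  exact eulerSeries_eq_prod hp0 hp1 z n

lemma eulerCoeffInt_natCast (k : ℕ) : eulerCoeffInt p k = eulerCoeff p k := by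
  simp [eulerCoeffInt]

lemma eulerCoeffInt_of_neg {n : ℤ} (hn : n < 0) : eulerCoeffInt p n = 0 := by
  simp [eulerCoeffInt, hn]

lemma eulerCoeffInt_mul_one_sub (hp0 : 0 < p) (hp1 : p < 1) (n : ℤ) :
    eulerCoeffInt p n * (1 - p ^ n) = -(p ^ (n - 1) * eulerCoeffInt p (n - 1)) := by
  rcases lt_or_ge n 0 with hn | hn
  · rw [eulerCoeffInt_of_neg hn, eulerCoeffInt_of_neg (by omega)]
    simp
  lift n to ℕ using hn
  cases n with
  | zero => simp [eulerCoeffInt_of_neg]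
  | succ k =>
    rw [show ((k + 1 : ℕ) : ℤ) - 1 = (k : ℤ) by push_cast; ring, eulerCoeffInt_natCast,
      eulerCoeffInt_natCast, zpow_natCast, zpow_natCast]
    exact eulerCoeff_succ_mul hp0 hp1 k

lemma eq_zero_of_notMem_range_natCast {f : ℤ → ℝ} (hf : ∀ n < 0, f n = 0) :
    ∀ n ∉ Set.range ((↑) : ℕ → ℤ), f n = 0 := by
  intro n hn
  refine hf n (lt_of_not_ge fun h => hn ?_)
  exact ⟨n.toNat, Int.toNat_of_nonneg h⟩

lemma summable_int_of_neg_eq_zero {f : ℤ → ℝ} (hf : ∀ n < 0, f n = 0)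
    (hs : Summable fun n : ℕ => f n) : Summable f :=
  (Function.Injective.summable_iff Nat.cast_injective (eq_zero_of_notMem_range_natCast hf)).1 hs

lemma tsum_int_of_neg_eq_zero {f : ℤ → ℝ} (hf : ∀ n < 0, f n = 0) :
    ∑' n : ℤ, f n = ∑' n : ℕ, f n := by
  refine (Function.Injective.tsum_eq (Nat.cast_injective (R := ℤ)) fun n hn => ?_).symm
  by_contra h
  exact hn (eq_zero_of_notMem_range_natCast hf n h)

lemma summable_eulerCoeffInt_mul_zpow (hp0 : 0 < p) (hp1 : p < 1) (z : ℝ) :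
    Summable fun n : ℤ => eulerCoeffInt p n * z ^ n := by
  refine summable_int_of_neg_eq_zero (fun n hn => by simp [eulerCoeffInt_of_neg hn]) ?_
  simpa [eulerCoeffInt_natCast] using summable_eulerCoeff_mul_pow hp0 hp1 z

lemma summable_eulerCoeffInt (hp0 : 0 < p) (hp1 : p < 1) : Summable (eulerCoeffInt p) := by
  simpa using summable_eulerCoeffInt_mul_zpow hp0 hp1 1

lemma invEulerCoeff_sub_one (hp0 : 0 < p) (hp1 : p < 1) (n : ℤ) :
    invEulerCoeff p (n - 1) = (1 - p ^ n) * invEulerCoeff p n := by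
  rw [invEulerCoeff, invEulerCoeff, sub_add_cancel, eulerSeries_eq hp0 hp1 (p ^ n),
    zpow_add_one₀ hp0.ne', mul_div_assoc]

lemma invEulerCoeff_zero (hp0 : 0 < p) (hp1 : p < 1) : invEulerCoeff p 0 = 1 := by
  simp [invEulerCoeff, eulerSeries_ne_zero hp0 hp1 hp0 hp1]

lemma invEulerCoeff_of_neg (hp0 : 0 < p) (hp1 : p < 1) {n : ℤ} (hn : n < 0) :
    invEulerCoeff p n = 0 := by
  have h : ∀ k : ℕ, invEulerCoeff p (-1 - k) = 0 := by
    intro k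
    induction k with
    | zero => simpa using invEulerCoeff_sub_one hp0 hp1 0
    | succ k ih =>
      rw [show (-1 - ((k + 1 : ℕ) : ℤ)) = (-1 - (k : ℤ)) - 1 by push_cast; ring,
        invEulerCoeff_sub_one hp0 hp1, ih, mul_zero]
  have := h (-1 - n).toNat
  rwa [Int.toNat_of_nonneg (by omega), sub_sub_cancel] at this

lemma exists_abs_invEulerCoeff_le (hp0 : 0 < p) (hp1 : p < 1) :
    ∃ B, ∀ n, |invEulerCoeff p n| ≤ B := by
  refine ⟨(∑' k, |eulerCoeff p k|) / |eulerSeries p p|, fun n => ?_⟩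
  rcases lt_or_ge n 0 with hn | hn
  · rw [invEulerCoeff_of_neg hp0 hp1 hn, abs_zero]
    exact div_nonneg (tsum_nonneg fun _ => abs_nonneg _) (abs_nonneg _)
  · rw [invEulerCoeff, abs_div]
    gcongr
    refine abs_eulerSeries_le hp0 hp1 ?_
    rw [abs_of_nonneg (zpow_nonneg hp0.le _)]
    exact zpow_le_one₀ hp0 hp1.le (by omega)

lemma summable_mul_of_abs_le {ι : Type*} {u w : ι → ℝ} {B : ℝ} (hu : Summable u)
    (hw : ∀ i, |w i| ≤ B) : Summable fun i => u i * w i := by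
  refine Summable.of_norm_bounded (hu.norm.mul_right B) fun i => ?_
  rw [norm_mul]
  exact mul_le_mul_of_nonneg_left (hw i) (norm_nonneg _)

/-- The coefficient form of `(z;p)_∞ * (1 / (z;p)_∞) = 1`. -/
lemma tsum_eulerCoeffInt_mul_invEulerCoeff (hp0 : 0 < p) (hp1 : p < 1) (n : ℤ) :
    ∑' j : ℤ, eulerCoeffInt p j * invEulerCoeff p (n - j) = if n = 0 then 1 else 0 := by
  obtain ⟨B, hB⟩ := exists_abs_invEulerCoeff_le hp0 hp1
  split_ifs with hn
  · subst hn
    rw [tsum_eq_single 0]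
    · have : eulerCoeffInt p 0 = 1 := by simpa [eulerCoeff_zero] using eulerCoeffInt_natCast 0
      simp [this, invEulerCoeff_zero hp0 hp1]
    · intro j hj
      rcases lt_or_gt_of_ne hj with h | h
      · rw [eulerCoeffInt_of_neg h, zero_mul]
      · rw [invEulerCoeff_of_neg hp0 hp1 (by omega), mul_zero]
  · set c := ∑' j : ℤ, eulerCoeffInt p j * invEulerCoeff p (n - j) with hc
    have hs2 : Summable fun j : ℤ => eulerCoeffInt p j * p ^ j * invEulerCoeff p (n - 1 - j) :=
      summable_mul_of_abs_le (summable_eulerCoeffInt_mul_zpow hp0 hp1 p) fun j => hB _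
    have hs3 := (Equiv.subRight (1 : ℤ)).summable_iff.2 hs2
    have key : (1 - p ^ n) * c = 0 := by
      calc (1 - p ^ n) * c
          = ∑' j : ℤ, (eulerCoeffInt p j * p ^ j * invEulerCoeff p (n - 1 - j) -
              eulerCoeffInt p (j - 1) * p ^ (j - 1) * invEulerCoeff p (n - 1 - (j - 1))) := by
            rw [hc, ← tsum_mul_left]
            refine tsum_congr fun j => ?_
            have h1 := eulerCoeffInt_mul_one_sub hp0 hp1 j
            have h2 := invEulerCoeff_sub_one hp0 hp1 (n - j)
            rw [show n - 1 - (j - 1) = n - j by ring, show n - 1 - j = n - j - 1 by ring, h2]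
            have h3 : p ^ n = p ^ j * p ^ (n - j) := by
              rw [← zpow_add₀ hp0.ne', add_sub_cancel]
            rw [h3]
            linear_combination invEulerCoeff p (n - j) * h1
        _ = 0 := by
            refine (hs2.tsum_sub hs3).trans (sub_eq_zero.2 ?_)
            exact ((Equiv.subRight (1 : ℤ)).tsum_eq
              (fun j => eulerCoeffInt p j * p ^ j * invEulerCoeff p (n - 1 - j))).symm
    refine (mul_eq_zero.1 key).resolve_left fun h => hn ?_
    exact (zpow_eq_one_iff_right₀ hp0.le hp1.ne).1 (sub_eq_zero.1 h).symm

lemma exists_abs_besselCoeff_le (hp0 : 0 < p) (hp1 : p < 1) (a : ℝ) :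
    ∃ B, ∀ n, |besselCoeff p a n| ≤ B := by
  obtain ⟨B, hB⟩ := exists_abs_invEulerCoeff_le hp0 hp1
  refine ⟨∑' i : ℤ, ‖eulerCoeffInt p i * a ^ i‖ * B, fun n => ?_⟩
  rw [← Real.norm_eq_abs, besselCoeff]
  refine tsum_of_norm_bounded
    ((summable_eulerCoeffInt_mul_zpow hp0 hp1 a).norm.mul_right B).hasSum fun i => ?_
  rw [norm_mul]
  exact mul_le_mul_of_nonneg_left (hB _) (norm_nonneg _)

lemma tsum_eulerCoeffInt_mul_besselCoeff (hp0 : 0 < p) (hp1 : p < 1) (a : ℝ) (n : ℤ) :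
    ∑' j : ℤ, eulerCoeffInt p j * besselCoeff p a (n - j) = eulerCoeffInt p (-n) * a ^ (-n) := by
  obtain ⟨B, hB⟩ := exists_abs_invEulerCoeff_le hp0 hp1
  unfold besselCoeff
  rw [tsum_mul_tsum_mul_comm (summable_eulerCoeffInt hp0 hp1)
    (summable_eulerCoeffInt_mul_zpow hp0 hp1 a) (fun i j => hB _)]
  simp_rw [sub_add_eq_add_sub, tsum_eulerCoeffInt_mul_invEulerCoeff hp0 hp1]
  rw [tsum_eq_single (-n)]
  · simp
  · intro j hj
    rw [if_neg (by omega), mul_zero]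

lemma zpow_mul_besselCoeff (ha : a ≠ 0) (m : ℤ) :
    a ^ m * besselCoeff p a m = ∑' l : ℤ, a ^ l * invEulerCoeff p l * eulerCoeffInt p (l - m) := by
  rw [besselCoeff, ← tsum_mul_left, ← (Equiv.addLeft m).tsum_eq
    fun l => a ^ l * invEulerCoeff p l * eulerCoeffInt p (l - m)]
  refine tsum_congr fun i => ?_
  simp only [Equiv.coe_addLeft, add_sub_cancel_left]
  rw [zpow_add₀ ha]
  ring

lemma summable_zpow_mul_invEulerCoeff (hp0 : 0 < p) (hp1 : p < 1) (ha0 : 0 < a) (ha1 : a < 1) :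
    Summable fun l : ℤ => a ^ l * invEulerCoeff p l := by
  obtain ⟨B, hB⟩ := exists_abs_invEulerCoeff_le hp0 hp1
  refine summable_int_of_neg_eq_zero
    (fun n hn => by rw [invEulerCoeff_of_neg hp0 hp1 hn, mul_zero]) ?_
  refine summable_mul_of_abs_le ?_ fun i => hB _
  simpa using summable_geometric_of_lt_one ha0.le ha1

lemma summable_zpow_mul_besselCoeff (hp0 : 0 < p) (hp1 : p < 1) (ha0 : 0 < a) (ha1 : a < 1) :
    Summable fun m : ℤ => a ^ m * besselCoeff p a m := by
  simp_rw [zpow_mul_besselCoeff ha0.ne']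
  simpa using summable_mul_tsum_convolution (summable_zpow_mul_invEulerCoeff hp0 hp1 ha0 ha1)
    (summable_eulerCoeffInt hp0 hp1) (χ := fun _ => 1) (B := 1) (by simp)

lemma tsum_zpow_mul_besselCoeff_mul_besselCoeff (hp0 : 0 < p) (hp1 : p < 1) (ha0 : 0 < a)
    (ha1 : a < 1) (s : ℤ) :
    ∑' m : ℤ, a ^ m * besselCoeff p a m * besselCoeff p a (m + s) = if s = 0 then 1 else 0 := by
  obtain ⟨B, hB⟩ := exists_abs_besselCoeff_le hp0 hp1 a
  simp_rw [zpow_mul_besselCoeff ha0.ne', mul_comm _ (besselCoeff p a (_ + s))]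
  rw [tsum_mul_tsum_convolution (summable_zpow_mul_invEulerCoeff hp0 hp1 ha0 ha1)
    (summable_eulerCoeffInt hp0 hp1) (χ := fun m => besselCoeff p a (m + s)) (fun _ => hB _)]
  simp_rw [sub_add_eq_add_sub, tsum_eulerCoeffInt_mul_besselCoeff hp0 hp1]
  calc ∑' l : ℤ, a ^ l * invEulerCoeff p l * (eulerCoeffInt p (-(l + s)) * a ^ (-(l + s)))
      = ∑' l : ℤ, a ^ (-s) * (eulerCoeffInt p (-s - l) * invEulerCoeff p l) := by
        refine tsum_congr fun l => ?_
        rw [show -(l + s) = -s - l by ring, zpow_sub₀ ha0.ne']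
        have := zpow_ne_zero l ha0.ne'
        field_simp
    _ = a ^ (-s) * ∑' j : ℤ, eulerCoeffInt p j * invEulerCoeff p (-s - j) := by
        rw [tsum_mul_left, ← (Equiv.subLeft (-s)).tsum_eq
          fun j => eulerCoeffInt p j * invEulerCoeff p (-s - j)]
        simp
    _ = _ := by
        rw [tsum_eulerCoeffInt_mul_invEulerCoeff hp0 hp1]
        by_cases h : s = 0 <;> simp [h]

lemma tsum_besselCoeff_orthogonality (hp0 : 0 < p) (hp1 : p < 1) (ha0 : 0 < a)
    (ha1 : a < 1) (k n : ℤ) :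
    ∑' m : ℤ, a ^ m * besselCoeff p a (k + m) * besselCoeff p a (m + n) =
      if n = k then a ^ (-k) else 0 := by
  calc ∑' m : ℤ, a ^ m * besselCoeff p a (k + m) * besselCoeff p a (m + n)
      = ∑' m : ℤ, a ^ (-k) * (a ^ m * besselCoeff p a m * besselCoeff p a (m + (n - k))) := by
        rw [← (Equiv.subRight k).tsum_eq
          fun m => a ^ m * besselCoeff p a (k + m) * besselCoeff p a (m + n)]
        refine tsum_congr fun m => ?_
        rw [Equiv.subRight_apply, show k + (m - k) = m by ring,
          show m - k + n = m + (n - k) by ring, sub_eq_add_neg m k, zpow_add₀ ha0.ne']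
        ring
    _ = _ := by
        rw [tsum_mul_left, tsum_zpow_mul_besselCoeff_mul_besselCoeff hp0 hp1 ha0 ha1]
        simp [sub_eq_zero]

/-- The symmetry `(a;p)_∞ ₁φ₁(0;a;p,z) = (z;p)_∞ ₁φ₁(0;z;p,a)`, for `z = p ^ (n + 1)`. -/
lemma tsum_eulerCoeff_mul_eulerSeries (hp0 : 0 < p) (hp1 : p < 1) (a : ℝ) (n : ℤ) :
    ∑' k : ℕ, eulerCoeff p k * (p ^ (n + 1)) ^ k * eulerSeries p (a * p ^ k) =
      eulerSeries p p * besselCoeff p a n := by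
  have h := tsum_mul_tsum_mul_comm (summable_eulerCoeff_mul_pow hp0 hp1 (p ^ (n + 1)))
    (summable_eulerCoeff_mul_pow hp0 hp1 a) (M := fun k i => p ^ (k * i)) (B := 1)
    (fun k i => by
      rw [abs_of_pos (pow_pos hp0 _)]
      exact pow_le_one₀ hp0.le hp1.le)
  rw [besselCoeff, tsum_int_of_neg_eq_zero fun i hi => by simp [eulerCoeffInt_of_neg hi],
    ← tsum_mul_left]
  convert h using 1
  · refine tsum_congr fun k => ?_
    congr 1
    exact tsum_congr fun i => by rw [mul_pow, ← pow_mul, mul_assoc]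
  · refine tsum_congr fun i => ?_
    rw [eulerCoeffInt_natCast, zpow_natCast, mul_left_comm, invEulerCoeff,
      mul_div_cancel₀ _ (eulerSeries_ne_zero hp0 hp1 hp0 hp1)]
    congr 1
    refine tsum_congr fun k => ?_
    rw [show n + (i : ℤ) + 1 = (n + 1) + i by ring, zpow_add₀ hp0.ne', mul_pow, mul_assoc,
      zpow_natCast, ← pow_mul, mul_comm i k]

end Euler

section Bessel

variable {q v : ℝ}

lemma qPow_div_qPoch (hq0 : 0 < q) (hq1 : q < 1) (k : ℕ) :
    (-1 : ℝ) ^ k * q ^ (k * (k + 1)) / qPoch (q ^ 2) (q ^ 2) k =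
      eulerCoeff (q ^ 2) k * (q ^ 2) ^ k := by
  induction k with
  | zero => simp [qPoch, eulerCoeff]
  | succ k ih =>
    have hk := (one_sub_pow_succ_pos (pow_pos hq0 2) (pow_lt_one₀ hq0.le hq1 two_ne_zero) k).ne'
    have h1 : qPoch (q ^ 2) (q ^ 2) (k + 1) =
        qPoch (q ^ 2) (q ^ 2) k * (1 - (q ^ 2) ^ (k + 1)) := by
      rw [qPoch, Finset.prod_range_succ, qPoch, ← pow_succ']
    have h2 : q ^ ((k + 1) * (k + 1 + 1)) = q ^ (k * (k + 1)) * ((q ^ 2) ^ k * q ^ 2) := by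
      rw [← pow_succ, ← pow_mul, ← pow_add]
      congr 1
      ring
    rw [h1, h2, eulerCoeff_succ, pow_succ, pow_succ (q ^ 2) k]
    rw [pow_succ (q ^ 2) k] at hk
    calc _ = (-1 : ℝ) ^ k * q ^ (k * (k + 1)) / qPoch (q ^ 2) (q ^ 2) k *
          (-((q ^ 2) ^ k * q ^ 2) / (1 - (q ^ 2) ^ k * q ^ 2)) := by
          rw [div_mul_div_comm]
          ring
      _ = _ := by rw [ih]; ring

lemma jHE_zpow (hq0 : 0 < q) (hq1 : q < 1) (hv : -1 < v) (n : ℤ) :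
    jHE q v (q ^ n) = eulerSeries (q ^ 2) (q ^ 2) / eulerSeries (q ^ 2) (q ^ (2 * v + 2)) *
      besselCoeff (q ^ 2) (q ^ (2 * v + 2)) n := by
  have hp0 : 0 < q ^ 2 := pow_pos hq0 2
  have hp1 : q ^ 2 < 1 := pow_lt_one₀ hq0.le hq1 two_ne_zero
  set a := q ^ (2 * v + 2) with ha
  have ha0 : 0 < a := Real.rpow_pos_of_pos hq0 _
  have ha1 : a < 1 := Real.rpow_lt_one hq0.le hq1 (by linarith)
  have hne := eulerSeries_ne_zero hp0 hp1 ha0 ha1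
  rw [div_mul_eq_mul_div, ← tsum_eulerCoeff_mul_eulerSeries hp0 hp1, jHE, ← tsum_div_const]
  refine tsum_congr fun k => ?_
  have hk := eulerSeries_eq_prod hp0 hp1 a k
  have hk' : qPoch a (q ^ 2) k ≠ 0 := fun h => hne (by rw [hk, h, zero_mul])
  have hk'' : eulerSeries (q ^ 2) (a * (q ^ 2) ^ k) / eulerSeries (q ^ 2) a =
      1 / qPoch a (q ^ 2) k := by
    rw [div_eq_div_iff hne hk', hk]
    ring
  have hz : ((q ^ 2) ^ (n + 1)) ^ k = (q ^ 2) ^ k * (q ^ n) ^ (2 * k) := by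
    rw [zpow_add_one₀ hp0.ne', mul_pow, mul_comm, pow_mul (q ^ n), ← zpow_natCast q 2,
      zpow_comm, zpow_natCast, zpow_natCast]
  rw [mul_div_assoc _ (eulerSeries _ _), hk'', hz, ← mul_assoc, ← qPow_div_qPoch hq0 hq1,
    div_mul_eq_mul_div, div_mul_div_comm, mul_one]

lemma one_sub_mul_cqv (hq0 : 0 < q) (hq1 : q < 1) :
    cqv q v * (1 - q) =
      eulerSeries (q ^ 2) (q ^ (2 * v + 2)) / eulerSeries (q ^ 2) (q ^ 2) := by
  have hp0 : 0 < q ^ 2 := pow_pos hq0 2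
  have hp1 : q ^ 2 < 1 := pow_lt_one₀ hq0.le hq1 two_ne_zero
  have := (sub_pos.2 hq1).ne'
  rw [cqv, qPochInf_eq_eulerSeries hp0 hp1, qPochInf_eq_eulerSeries hp0 hp1]
  field_simp

lemma zpow_mul_zpow_rpow (hq0 : 0 < q) (n : ℤ) :
    q ^ n * (q ^ n) ^ (2 * v + 1 : ℝ) = (q ^ (2 * v + 2 : ℝ)) ^ n := by
  rw [← Real.rpow_intCast, ← Real.rpow_mul hq0.le, ← Real.rpow_add hq0, ← Real.rpow_intCast,
    ← Real.rpow_mul hq0.le]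
  congr 1
  ring

lemma qFourier_zpow (hq0 : 0 < q) (hq1 : q < 1) (hv : -1 < v) (f : ℝ → ℝ) (m : ℤ) :
    qFourier q v f (q ^ m) = ∑' n : ℤ, (q ^ (2 * v + 2 : ℝ)) ^ n * f (q ^ n) *
      besselCoeff (q ^ 2) (q ^ (2 * v + 2)) (m + n) := by
  have hp0 : 0 < q ^ 2 := pow_pos hq0 2
  have hp1 : q ^ 2 < 1 := pow_lt_one₀ hq0.le hq1 two_ne_zero
  have hne := eulerSeries_ne_zero hp0 hp1 (Real.rpow_pos_of_pos hq0 (2 * v + 2))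
    (Real.rpow_lt_one hq0.le hq1 (by linarith))
  have hne' := eulerSeries_ne_zero hp0 hp1 hp0 hp1
  rw [qFourier, jackson, ← mul_assoc, one_sub_mul_cqv hq0 hq1, ← tsum_mul_left]
  refine tsum_congr fun n => ?_
  rw [← zpow_add₀ hq0.ne', jHE_zpow hq0 hq1 hv, ← zpow_mul_zpow_rpow hq0]
  generalize q ^ (2 * v + 2) = a at hne ⊢
  field_simp

end Bessel

/-- the q-Bessel Fourier transform is involutive on `L_{q,1,v}`. -/
theorem stmt1 (q v : ℝ) (hq0 : 0 < q) (hq1 : q < 1) (hv : -1 < v)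
    (f : ℝ → ℝ) (hf : memL1 q v f) :
    ∀ x ∈ Rq q, qFourier q v (qFourier q v f) x = f x := by
  rintro x ⟨k, rfl⟩
  have hp0 : 0 < q ^ 2 := pow_pos hq0 2
  have hp1 : q ^ 2 < 1 := pow_lt_one₀ hq0.le hq1 two_ne_zero
  have ha0 : 0 < q ^ (2 * v + 2) := Real.rpow_pos_of_pos hq0 _
  have ha1 : q ^ (2 * v + 2) < 1 := Real.rpow_lt_one hq0.le hq1 (by linarith)
  have hF := qFourier_zpow hq0 hq1 hv f
  rw [qFourier_zpow hq0 hq1 hv]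
  simp_rw [hF]
  set a := q ^ (2 * v + 2) with ha
  obtain ⟨B, hB⟩ := exists_abs_besselCoeff_le hp0 hp1 a
  have hsf : Summable fun n : ℤ => a ^ n * f (q ^ n) := by
    refine Summable.of_norm (Summable.congr hf fun n => ?_)
    rw [norm_mul, Real.norm_of_nonneg (zpow_nonneg ha0.le n), ha, ← zpow_mul_zpow_rpow hq0,
      Real.norm_eq_abs]
    ring
  have hsb : Summable fun m : ℤ => a ^ m * besselCoeff (q ^ 2) a (k + m) := by
    have h := ((Equiv.addLeft k).summable_iff.2
      (summable_zpow_mul_besselCoeff hp0 hp1 ha0 ha1)).mul_left (a ^ (-k))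
    refine h.congr fun m => ?_
    rw [Function.comp_apply, Equiv.coe_addLeft, ← mul_assoc, ← zpow_add₀ ha0.ne',
      neg_add_cancel_left]
  calc _ = ∑' m : ℤ, a ^ m * besselCoeff (q ^ 2) a (k + m) *
        ∑' n : ℤ, a ^ n * f (q ^ n) * besselCoeff (q ^ 2) a (m + n) :=
        tsum_congr fun m => by ring
    _ = ∑' n : ℤ, a ^ n * f (q ^ n) * if n = k then a ^ (-k) else 0 := by
        rw [tsum_mul_tsum_mul_comm hsb hsf fun _ _ => hB _]
        simp_rw [tsum_besselCoeff_orthogonality hp0 hp1 ha0 ha1]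
    _ = f (q ^ k) := by
        rw [tsum_eq_single k fun n hn => by rw [if_neg hn, mul_zero], if_pos rfl, zpow_neg]
        field_simp [(zpow_pos ha0 k).ne']
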